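/- Let X be a type, U a type, f : ℕ → X → U → X the dynamics, ℓ_t, g_t : X → ℝ margin functions, and T a finite horizon. Suppose a feedback policy γ* : ℕ → X → U is strongly time-consistent: for every s' ≤ T, every state x̃ ∈ X, and every feedback policy γ', J_{s'}(x^{γ*}_{s',x̃}) ≤ J_{s'}(x^{γ'}_{s',x̃}), where x^{γ}_{s,x̃} denotes the closed-loop trajectory from (s, x̃) under γ. Then γ* is weakly time-consistent: for every s ≤ T, every initial state x_0, and every feedback policy γ that agrees with γ* at all times t < s, J_s(x^{γ*}_{0,x_0}) ≤ J_s(x^{γ}_{0,x_0}). That is, strong time consistency implies weak time consistency for reach-avoid problems. -/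

import Mathlib

/-- Reach-avoid objective-to-go: J_s = min_{t∈{s,…,T}} max{a_t, max_{τ∈{s,…,t}} b_τ}. -/
noncomputable def raJ (T : ℕ) (a b : ℕ → ℝ) (s : ℕ) (hs : s ≤ T) : ℝ :=
  (Finset.Icc s T).attach.inf'
    (Finset.attach_nonempty_iff.mpr (Finset.nonempty_Icc.mpr hs))
    fun t => max (a t.1)
      ((Finset.Icc s t.1).sup' (Finset.nonempty_Icc.mpr (Finset.mem_Icc.mp t.2).1) b)

/-- Closed-loop trajectory under feedback policy `γ`:
`x_s = x`, `x_{t+1} = f_t(x_t, γ_t(x_t))` for `t ≥ s`. -/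
def ctraj {X U : Type*} (f : ℕ → X → U → X) (γ : ℕ → X → U) (s : ℕ) (x : X) (t : ℕ) : X :=
  Nat.rec (motive := fun _ => X) x (fun k xk => f (s + k) xk (γ (s + k) xk)) (t - s)

theorem raJ_congr {T s : ℕ} (hs : s ≤ T) {a a' b b' : ℕ → ℝ}
    (ha : ∀ t, s ≤ t → a t = a' t) (hb : ∀ t, s ≤ t → b t = b' t) :
    raJ T a b s hs = raJ T a' b' s hs := by
  unfold raJ
  refine Finset.inf'_congr _ rfl fun t _ => ?_
  rw [ha t.1 (Finset.mem_Icc.mp t.2).1]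
  congr 1
  exact Finset.sup'_congr _ rfl fun τ hτ => hb τ (Finset.mem_Icc.mp hτ).1

theorem ctraj_self {X U : Type*} (f : ℕ → X → U → X) (γ : ℕ → X → U) (s : ℕ) (x : X) :
    ctraj f γ s x s = x := by
  simp [ctraj]

theorem ctraj_succ {X U : Type*} (f : ℕ → X → U → X) (γ : ℕ → X → U) {s t : ℕ} (x : X)
    (h : s ≤ t) :
    ctraj f γ s x (t + 1) = f t (ctraj f γ s x t) (γ t (ctraj f γ s x t)) := by
  obtain ⟨k, rfl⟩ := Nat.exists_eq_add_of_le h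
  simp [ctraj, Nat.add_assoc]

theorem ctraj_ctraj {X U : Type*} (f : ℕ → X → U → X) (γ : ℕ → X → U) {r s t : ℕ} (x : X)
    (hrs : r ≤ s) (hst : s ≤ t) :
    ctraj f γ s (ctraj f γ r x s) t = ctraj f γ r x t := by
  induction t, hst using Nat.le_induction with
  | base => exact ctraj_self ..
  | succ t hst ih => rw [ctraj_succ f γ _ hst, ctraj_succ f γ _ (hrs.trans hst), ih]

theorem ctraj_congr {X U : Type*} (f : ℕ → X → U → X) {γ γ' : ℕ → X → U} {r s : ℕ} (x : X)
    (hrs : r ≤ s) (h : ∀ t, t < s → γ t = γ' t) :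
    ctraj f γ r x s = ctraj f γ' r x s := by
  induction s, hrs using Nat.le_induction with
  | base => rw [ctraj_self, ctraj_self]
  | succ s hrs ih =>
    rw [ctraj_succ f γ _ hrs, ctraj_succ f γ' _ hrs, ih fun t ht => h t (by omega),
      h s s.lt_succ_self]

theorem raJ_ctraj_restart {X U : Type*} (f : ℕ → X → U → X) (ℓ g : ℕ → X → ℝ)
    (γ : ℕ → X → U) {r s T : ℕ} (hrs : r ≤ s) (hs : s ≤ T) (x : X) :
    raJ T (fun t => ℓ t (ctraj f γ s (ctraj f γ r x s) t))
          (fun t => g t (ctraj f γ s (ctraj f γ r x s) t)) s hs =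
      raJ T (fun t => ℓ t (ctraj f γ r x t)) (fun t => g t (ctraj f γ r x t)) s hs :=
  raJ_congr hs (fun t ht => by rw [ctraj_ctraj f γ x hrs ht])
    fun t ht => by rw [ctraj_ctraj f γ x hrs ht]

/-- Strong time consistency implies weak time consistency for reach-avoid
problems: if `γ*` is optimal for the truncated problem from every intermediate
time and every state (against every feedback policy), then for every `s ≤ T`,
initial state `x₀`, and policy `γ` agreeing with `γ*` before time `s`, the
objective-to-go `J_s` along the trajectory from `(0, x₀)` under `γ*` is no worse
than under `γ`. -/
theorem strong_time_consistency_implies_weak_time_consistency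
    {X U : Type*} (f : ℕ → X → U → X) (ℓ g : ℕ → X → ℝ) (T : ℕ)
    (γstar : ℕ → X → U)
    (hstrong : ∀ s' (hs' : s' ≤ T), ∀ xtilde : X, ∀ γ' : ℕ → X → U,
      raJ T (fun t => ℓ t (ctraj f γstar s' xtilde t))
            (fun t => g t (ctraj f γstar s' xtilde t)) s' hs' ≤
        raJ T (fun t => ℓ t (ctraj f γ' s' xtilde t))
              (fun t => g t (ctraj f γ' s' xtilde t)) s' hs') :
    ∀ s (hs : s ≤ T), ∀ x₀ : X, ∀ γ : ℕ → X → U,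
      (∀ t, t < s → γ t = γstar t) →
      raJ T (fun t => ℓ t (ctraj f γstar 0 x₀ t))
            (fun t => g t (ctraj f γstar 0 x₀ t)) s hs ≤
        raJ T (fun t => ℓ t (ctraj f γ 0 x₀ t))
              (fun t => g t (ctraj f γ 0 x₀ t)) s hs := by
  intro s hs x₀ γ hγ
  have h := hstrong s hs (ctraj f γstar 0 x₀ s) γ
  rwa [raJ_ctraj_restart f ℓ g γstar s.zero_le, ← ctraj_congr f x₀ s.zero_le hγ,
    raJ_ctraj_restart f ℓ g γ s.zero_le] at h
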